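/- arXiv:1507.03689 — 2 statements merged into one kernel-verified Lean document; each statement's English description precedes it below -/
import Mathlib

section
/- In a Zappa–Szép system (𝒢, 𝒣, ·, |), every element of 𝒢⋈𝒣 factors as a 𝒣-part followed by a 𝒢-part: for all arrows g of 𝒢 and h of 𝒣 with t(g) = l(h), one has (h|_{h⁻¹·g⁻¹}) · ((h⁻¹|_{g⁻¹}) · g) = g and (h|_{h⁻¹·g⁻¹})|_{(h⁻¹|_{g⁻¹})·g} = h; equivalently, in 𝒢⋈𝒣, (g,h) = (b(g), h|_{h⁻¹·g⁻¹})((h⁻¹|_{g⁻¹})·g, r(h)), where b(g) and r(h) denote identity arrows. -/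
/-- An (algebraic) groupoid with object set `U`: a set of arrows `Arr`, each with a
source and a range in `U`, an identity arrow at each object, a multiplication
(total as a function, but only constrained on composable pairs, i.e. when the
source of the first arrow equals the range of the second) and inversion. -/
structure GroupoidOn (U : Type*) where
  Arr : Type*
  src : Arr → U
  rng : Arr → U
  unit : U → Arr
  mul : Arr → Arr → Arr
  inv : Arr → Arr
  src_unit : ∀ u, src (unit u) = u
  rng_unit : ∀ u, rng (unit u) = u
  rng_mul : ∀ g₁ g₂, src g₁ = rng g₂ → rng (mul g₁ g₂) = rng g₁
  src_mul : ∀ g₁ g₂, src g₁ = rng g₂ → src (mul g₁ g₂) = src g₂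
  src_inv : ∀ g, src (inv g) = rng g
  rng_inv : ∀ g, rng (inv g) = src g
  mul_assoc : ∀ g₁ g₂ g₃, src g₁ = rng g₂ → src g₂ = rng g₃ →
    mul (mul g₁ g₂) g₃ = mul g₁ (mul g₂ g₃)
  unit_mul : ∀ g, mul (unit (rng g)) g = g
  mul_unit : ∀ g, mul g (unit (src g)) = g
  mul_inv : ∀ g, mul g (inv g) = unit (rng g)
  inv_mul : ∀ g, mul (inv g) g = unit (src g)

/-- A Zappa–Szép system on a pair of groupoids `G`, `H` with the same object set `U`.
For an arrow `g` of `G`, `b g := G.rng g` and `t g := G.src g`; for an arrow `h` of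
`H`, `l h := H.rng h` and `r h := H.src h`.  The action `act h g` and restriction
`res h g` are constrained only for pairs with `r h = b g`, and satisfy (ZS1)–(ZS9). -/
structure ZSSystem {U : Type*} (G H : GroupoidOn U) where
  act : H.Arr → G.Arr → G.Arr
  res : H.Arr → G.Arr → H.Arr
  zs1 : ∀ h₁ h₂ g, H.src h₁ = H.rng h₂ → H.src h₂ = G.rng g →
      act (H.mul h₁ h₂) g = act h₁ (act h₂ g)
  zs2 : ∀ h g₁ g₂, H.src h = G.rng g₁ → G.src g₁ = G.rng g₂ →
      act h (G.mul g₁ g₂) = G.mul (act h g₁) (act (res h g₁) g₂)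
  zs3 : ∀ h g₁ g₂, H.src h = G.rng g₁ → G.src g₁ = G.rng g₂ →
      res h (G.mul g₁ g₂) = res (res h g₁) g₂
  zs4 : ∀ h₁ h₂ g, H.src h₁ = H.rng h₂ → H.src h₂ = G.rng g →
      res (H.mul h₁ h₂) g = H.mul (res h₁ (act h₂ g)) (res h₂ g)
  zs5 : ∀ h g, H.src h = G.rng g → G.rng (act h g) = H.rng h
  zs6 : ∀ h g, H.src h = G.rng g → H.src (res h g) = G.src g
  zs7 : ∀ h g, H.src h = G.rng g → G.src (act h g) = H.rng (res h g)
  zs8 : ∀ g, act (H.unit (G.rng g)) g = g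
  zs9 : ∀ h, res h (G.unit (H.src h)) = h

/-- Membership in the Zappa–Szép product `G ⋈ H`: a pair `(g,h)` belongs to `G ⋈ H`
exactly when `t(g) = l(h)`. -/
def zsMem {U : Type*} (G H : GroupoidOn U) (p : G.Arr × H.Arr) : Prop :=
  G.src p.1 = H.rng p.2

/-- The multiplication of the Zappa–Szép product:
`(g₁,h₁)(g₂,h₂) = (g₁(h₁·g₂), (h₁|_{g₂})h₂)` (defined when `r(h₁) = b(g₂)`). -/
def zsMul {U : Type*} {G H : GroupoidOn U} (Z : ZSSystem G H)
    (p q : G.Arr × H.Arr) : G.Arr × H.Arr :=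
  (G.mul p.1 (Z.act p.2 q.1), H.mul (Z.res p.2 q.1) q.2)

/-- The inversion of the Zappa–Szép product: `(g,h)⁻¹ = (h⁻¹·g⁻¹, h⁻¹|_{g⁻¹})`. -/
def zsInv {U : Type*} {G H : GroupoidOn U} (Z : ZSSystem G H)
    (p : G.Arr × H.Arr) : G.Arr × H.Arr :=
  (Z.act (H.inv p.2) (G.inv p.1), Z.res (H.inv p.2) (G.inv p.1))

theorem GroupoidOn.eq_unit_of_mul_self {U : Type*} (G : GroupoidOn U) (x : G.Arr)
    (hx : G.src x = G.rng x) (hxx : G.mul x x = x) : x = G.unit (G.src x) := by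
  have h := G.mul_assoc (G.inv x) x x (G.src_inv x) hx
  rw [hxx, G.inv_mul, hx, G.unit_mul] at h
  rwa [hx]

theorem ZSSystem.act_unit {U : Type*} {G H : GroupoidOn U} (Z : ZSSystem G H) (h : H.Arr) :
    Z.act h (G.unit (H.src h)) = G.unit (H.rng h) := by
  have hu : H.src h = G.rng (G.unit (H.src h)) := (G.rng_unit _).symm
  have hs : G.src (Z.act h (G.unit (H.src h))) = H.rng h := by rw [Z.zs7 _ _ hu, Z.zs9]
  have huu : G.mul (G.unit (H.src h)) (G.unit (H.src h)) = G.unit (H.src h) := by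
    simpa only [G.rng_unit] using G.unit_mul (G.unit (H.src h))
  have h2 := Z.zs2 h _ (G.unit (H.src h)) hu (by rw [G.src_unit, G.rng_unit])
  rw [huu, Z.zs9] at h2
  have h3 := G.eq_unit_of_mul_self _ (by rw [hs, Z.zs5 _ _ hu]) h2.symm
  rwa [hs] at h3

theorem ZSSystem.unit_res {U : Type*} {G H : GroupoidOn U} (Z : ZSSystem G H) (g : G.Arr) :
    Z.res (H.unit (G.rng g)) g = H.unit (G.src g) := by
  have hu : H.src (H.unit (G.rng g)) = G.rng g := H.src_unit _
  have huu : H.mul (H.unit (G.rng g)) (H.unit (G.rng g)) = H.unit (G.rng g) := by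
    simpa only [H.rng_unit] using H.unit_mul (H.unit (G.rng g))
  have h4 := Z.zs4 (H.unit (G.rng g)) _ g (by rw [H.src_unit, H.rng_unit]) hu
  rw [huu, Z.zs8] at h4
  have h5 := H.eq_unit_of_mul_self _ (by rw [Z.zs6 _ _ hu, ← Z.zs7 _ _ hu, Z.zs8]) h4.symm
  rwa [Z.zs6 _ _ hu] at h5

/-- Every element of `G ⋈ H` factors as an `H`-part followed by a `G`-part: for arrows
`g` of `G` and `h` of `H` with `t(g) = l(h)`, one has
`(h|_{h⁻¹·g⁻¹}) · ((h⁻¹|_{g⁻¹}) · g) = g` and `(h|_{h⁻¹·g⁻¹})|_{(h⁻¹|_{g⁻¹})·g} = h`;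
equivalently, in `G ⋈ H`,
`(g,h) = (b(g), h|_{h⁻¹·g⁻¹})((h⁻¹|_{g⁻¹})·g, r(h))`, where `b(g)` and `r(h)` denote
identity arrows. -/
theorem zs_reverse_factorization {U : Type*} (G H : GroupoidOn U) (Z : ZSSystem G H)
    (g : G.Arr) (h : H.Arr) (hm : G.src g = H.rng h) :
    Z.act (Z.res h (Z.act (H.inv h) (G.inv g))) (Z.act (Z.res (H.inv h) (G.inv g)) g) = g
    ∧ Z.res (Z.res h (Z.act (H.inv h) (G.inv g))) (Z.act (Z.res (H.inv h) (G.inv g)) g) = h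
    ∧ zsMul Z (G.unit (G.rng g), Z.res h (Z.act (H.inv h) (G.inv g)))
        (Z.act (Z.res (H.inv h) (G.inv g)) g, H.unit (H.src h)) = (g, h) := by
  have hinv : H.src (H.inv h) = G.rng (G.inv g) := by rw [H.src_inv, G.rng_inv, hm]
  have hact : H.src h = G.rng (Z.act (H.inv h) (G.inv g)) := by
    rw [Z.zs5 _ _ hinv, H.rng_inv]
  have hk : H.src (Z.res (H.inv h) (G.inv g)) = G.rng g := by rw [Z.zs6 _ _ hinv, G.src_inv]
  have hak : G.src (Z.act (H.inv h) (G.inv g)) = H.rng (Z.res (H.inv h) (G.inv g)) :=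
    Z.zs7 _ _ hinv
  have hmul : H.mul (Z.res h (Z.act (H.inv h) (G.inv g))) (Z.res (H.inv h) (G.inv g))
      = H.unit (G.rng g) := by
    rw [← Z.zs4 h (H.inv h) (G.inv g) (H.rng_inv h).symm hinv, H.mul_inv, ← hm,
      ← G.rng_inv g, Z.unit_res, G.src_inv]
  have hunit : G.mul (Z.act (H.inv h) (G.inv g)) (Z.act (Z.res (H.inv h) (G.inv g)) g)
      = G.unit (H.src h) := by
    rw [← Z.zs2 _ _ _ hinv (G.src_inv g), G.inv_mul, hm, ← H.src_inv h, Z.act_unit, H.rng_inv]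
  have hact_eq : Z.act (Z.res h (Z.act (H.inv h) (G.inv g)))
      (Z.act (Z.res (H.inv h) (G.inv g)) g) = g := by
    rw [← Z.zs1 _ _ _ (by rw [Z.zs6 _ _ hact, hak]) hk, hmul, Z.zs8]
  have hres_eq : Z.res (Z.res h (Z.act (H.inv h) (G.inv g)))
      (Z.act (Z.res (H.inv h) (G.inv g)) g) = h := by
    rw [← Z.zs3 _ _ _ hact (by rw [Z.zs5 _ _ hk, hak]), hunit, Z.zs9]
  refine ⟨hact_eq, hres_eq, ?_⟩
  simp only [zsMul, hact_eq, hres_eq, G.unit_mul, H.mul_unit]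
end

section
/- In a Zappa–Szép system (𝒢, 𝒣, ·, |), the reverse-order factorization is unique: let g be an arrow of 𝒢 and h an arrow of 𝒣 with t(g) = l(h); if h' is an arrow of 𝒣 and g' an arrow of 𝒢 with r(h') = b(g'), h'·g' = g and h'|_{g'} = h, then h' = h|_{h⁻¹·g⁻¹} and g' = (h⁻¹|_{g⁻¹})·g. -/
namespace GroupoidOn

theorem eq_unit_of_mul_self_s12 {U : Type*} (G : GroupoidOn U) (g : G.Arr)
    (hg : G.src g = G.rng g) (hgg : G.mul g g = g) : g = G.unit (G.rng g) := by
  have h1 := G.mul_assoc g g (G.inv g) hg (G.rng_inv g).symm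
  rw [hgg, G.mul_inv, ← hg, G.mul_unit, hg] at h1
  exact h1.symm

theorem eq_inv_of_mul_eq_unit {U : Type*} (G : GroupoidOn U) (a b : G.Arr)
    (hab : G.src a = G.rng b) (h : G.mul a b = G.unit (G.rng a)) : b = G.inv a := by
  have h1 := G.mul_assoc (G.inv a) a b (G.src_inv a) hab
  rw [G.inv_mul, hab, G.unit_mul, h, ← G.src_inv, G.mul_unit] at h1
  exact h1

end GroupoidOn

namespace ZSSystem

variable {U : Type*} {G H : GroupoidOn U}

theorem act_unit_s12 (Z : ZSSystem G H) (h : H.Arr) :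
    Z.act h (G.unit (H.src h)) = G.unit (H.rng h) := by
  have hb : H.src h = G.rng (G.unit (H.src h)) := (G.rng_unit _).symm
  have hs : G.src (G.unit (H.src h)) = G.rng (G.unit (H.src h)) := by
    rw [G.src_unit, G.rng_unit]
  have huu : G.mul (G.unit (H.src h)) (G.unit (H.src h)) = G.unit (H.src h) := by
    simpa only [G.src_unit] using G.mul_unit (G.unit (H.src h))
  have h2 := Z.zs2 h _ _ hb hs
  rw [huu, Z.zs9] at h2
  have h7 := Z.zs7 h _ hb
  rw [Z.zs9] at h7
  have h5 := Z.zs5 h _ hb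
  rw [← h5]
  exact G.eq_unit_of_mul_self_s12 _ (h7.trans h5.symm) h2.symm

theorem unit_res_s12 (Z : ZSSystem G H) (g : G.Arr) :
    Z.res (H.unit (G.rng g)) g = H.unit (G.src g) := by
  have hb : H.src (H.unit (G.rng g)) = G.rng g := H.src_unit _
  have hs : H.src (H.unit (G.rng g)) = H.rng (H.unit (G.rng g)) := by
    rw [H.src_unit, H.rng_unit]
  have huu : H.mul (H.unit (G.rng g)) (H.unit (G.rng g)) = H.unit (G.rng g) := by
    simpa only [H.src_unit] using H.mul_unit (H.unit (G.rng g))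
  have h4 := Z.zs4 _ _ g hs hb
  rw [huu, Z.zs8] at h4
  have h7 := Z.zs7 _ g hb
  rw [Z.zs8] at h7
  have h6 := Z.zs6 _ g hb
  rw [h7]
  exact H.eq_unit_of_mul_self_s12 _ (h6.trans h7) h4.symm

theorem res_act_inv (Z : ZSSystem G H) {h : H.Arr} {g : G.Arr} (hc : H.src h = G.rng g) :
    Z.act (Z.res h g) (G.inv g) = G.inv (Z.act h g) := by
  have h6 : H.src (Z.res h g) = G.rng (G.inv g) := by rw [Z.zs6 h g hc, G.rng_inv]
  refine G.eq_inv_of_mul_eq_unit _ _ ?_ ?_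
  · rw [Z.zs7 h g hc, Z.zs5 _ _ h6]
  · rw [← Z.zs2 h g _ hc (G.rng_inv g).symm, G.mul_inv, ← hc, Z.act_unit_s12, Z.zs5 h g hc]

theorem res_res_inv (Z : ZSSystem G H) {h : H.Arr} {g : G.Arr} (hc : H.src h = G.rng g) :
    Z.res (Z.res h g) (G.inv g) = h := by
  rw [← Z.zs3 h g _ hc (G.rng_inv g).symm, G.mul_inv, ← hc, Z.zs9]

theorem inv_act_act (Z : ZSSystem G H) {h : H.Arr} {g : G.Arr} (hc : H.src h = G.rng g) :
    Z.act (H.inv h) (Z.act h g) = g := by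
  rw [← Z.zs1 _ _ _ (H.src_inv h) hc, H.inv_mul, hc, Z.zs8]

theorem inv_res_act_mul_res (Z : ZSSystem G H) {h : H.Arr} {g : G.Arr}
    (hc : H.src h = G.rng g) :
    H.mul (Z.res (H.inv h) (Z.act h g)) (Z.res h g) = H.unit (G.src g) := by
  rw [← Z.zs4 _ _ _ (H.src_inv h) hc, H.inv_mul, hc, Z.unit_res_s12]

end ZSSystem

/-- The reverse-order factorization in a Zappa–Szép system is unique: let `g` be an arrow
of `G` and `h` an arrow of `H` with `t(g) = l(h)`; if `h'` is an arrow of `H` and `g'` an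
arrow of `G` with `r(h') = b(g')`, `h'·g' = g` and `h'|_{g'} = h`, then
`h' = h|_{h⁻¹·g⁻¹}` and `g' = (h⁻¹|_{g⁻¹})·g`. -/
theorem zs_reverse_factorization_unique {U : Type*} (G H : GroupoidOn U) (Z : ZSSystem G H)
    (g : G.Arr) (h : H.Arr) (hm : G.src g = H.rng h)
    (g' : G.Arr) (h' : H.Arr) (hc : H.src h' = G.rng g')
    (hact : Z.act h' g' = g) (hres : Z.res h' g' = h) :
    h' = Z.res h (Z.act (H.inv h) (G.inv g))
    ∧ g' = Z.act (Z.res (H.inv h) (G.inv g)) g := by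
  have hr : H.src h = G.rng (G.inv g') := by rw [← hres, Z.zs6 h' g' hc, G.rng_inv]
  have hinv : G.inv g = Z.act h (G.inv g') := by rw [← hact, ← hres, Z.res_act_inv hc]
  have hh' : Z.res h (G.inv g') = h' := by rw [← hres, Z.res_res_inv hc]
  rw [hinv, Z.inv_act_act hr]
  refine ⟨hh'.symm, ?_⟩
  have hk : H.src (Z.res (H.inv h) (Z.act h (G.inv g'))) = H.rng h' := by
    rw [Z.zs6 _ _ (by rw [H.src_inv, Z.zs5 h _ hr]), Z.zs7 h _ hr, hh']
  have hm' := Z.inv_res_act_mul_res hr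
  rw [hh', G.src_inv] at hm'
  rw [← hact, ← Z.zs1 _ _ _ hk hc, hm', Z.zs8]
end
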